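/- Let G be a finite group and π an irreducible unitary representation of G on a complex Hilbert space H. Then every abelian subalgebra A of B(H) satisfying π(g)Aπ(g)⁻¹ = A for all g ∈ G is self-adjoint. -/

import Mathlib

/-- A reduced commutative Artinian ring has finitely many square roots of `1`. -/
theorem finite_setOf_mul_self_eq_one_of_isReduced (R : Type*) [CommRing R] [IsArtinianRing R]
    [IsReduced R] : {u : R | u * u = 1}.Finite := by
  let e := IsArtinianRing.equivPi R
  refine Set.Finite.of_finite_image (f := e) ?_ e.injective.injOn
  refine (Set.Finite.pi' (t := fun I : MaximalSpectrum R => ({1, -1} : Set (R ⧸ I.asIdeal)))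
    fun _ => Set.toFinite _).subset ?_
  rintro _ ⟨u, hu, rfl⟩ I
  have h : e u * e u = 1 := by rw [← map_mul, show u * u = 1 from hu, map_one]
  exact mul_self_eq_one_iff.1 (congrFun h I)

/-- A finite-dimensional reduced commutative algebra over an algebraically closed field is
spanned by its idempotents. -/
theorem span_setOf_isIdempotentElem_of_isReduced (K R : Type*) [Field K] [IsAlgClosed K]
    [CommRing R] [Algebra K R] [Module.Finite K R] [IsReduced R] :
    Submodule.span K {p : R | IsIdempotentElem p} = ⊤ := by
  classical
  have : IsArtinianRing R := IsArtinianRing.of_finite K R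
  have := Fintype.ofFinite (MaximalSpectrum R)
  let e := IsArtinianRing.equivPi R
  refine Submodule.eq_top_iff'.2 fun x => ?_
  have hs : ∀ I : MaximalSpectrum R, ∃ c : K, algebraMap K (R ⧸ I.asIdeal) c = e x I := fun I =>
    (IsAlgClosed.algebraMap_bijective_of_isIntegral (k := K) (K := R ⧸ I.asIdeal)).2 _
  choose c hc using hs
  have hx : x = ∑ I, c I • e.symm (Pi.single I 1) := by
    apply e.injective
    rw [map_sum]
    funext J
    have hsm : ∀ (a : K) (y : R), e (a • y) J = algebraMap K (R ⧸ J.asIdeal) a * e y J := by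
      intro a y
      rw [Algebra.smul_def, map_mul, Pi.mul_apply]
      rfl
    simp only [Finset.sum_apply, hsm, e.apply_symm_apply]
    rw [Finset.sum_eq_single J, Pi.single_eq_same, mul_one, hc]
    · intro I _ hI
      rw [Pi.single_eq_of_ne hI.symm, mul_zero]
    · exact fun h => absurd (Finset.mem_univ J) h
  rw [hx]
  refine Submodule.sum_mem _ fun I _ => Submodule.smul_mem _ _ (Submodule.subset_span ?_)
  change _ * _ = _
  rw [← map_mul, ← Pi.single_mul, mul_one]

/-- A topologically irreducible representation of a finite group is finite-dimensional. -/
theorem finiteDimensional_of_finite_of_irreducible {G H : Type*} [Group G] [Finite G]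
    [NormedAddCommGroup H] [NormedSpace ℂ H] (ρ : G →* (H →L[ℂ] H))
    (hirr : ∀ U : Submodule ℂ H, IsClosed (U : Set H) →
      (∀ g : G, ∀ v ∈ U, ρ g v ∈ U) → U = ⊥ ∨ U = ⊤) :
    FiniteDimensional ℂ H := by
  rcases subsingleton_or_nontrivial H with _ | _
  · infer_instance
  obtain ⟨v, hv⟩ := exists_ne (0 : H)
  let U := Submodule.span ℂ (Set.range fun g => ρ g v)
  have hfin : FiniteDimensional ℂ U := FiniteDimensional.span_of_finite ℂ (Set.finite_range _)
  have hvU : v ∈ U := Submodule.subset_span ⟨1, by simp⟩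
  have hinv : ∀ g : G, ∀ w ∈ U, ρ g w ∈ U := by
    intro g w hw
    have hle : U ≤ U.comap (ρ g : H →ₗ[ℂ] H) := by
      refine Submodule.span_le.2 ?_
      rintro _ ⟨k, rfl⟩
      exact Submodule.subset_span ⟨g * k, by simp⟩
    exact hle hw
  rcases hirr U U.closed_of_finiteDimensional hinv with h | h
  · exact absurd ((Submodule.mem_bot ℂ).1 (h ▸ hvU)) hv
  · rw [h] at hfin
    exact Submodule.topEquiv.finiteDimensional

/-- Schur's lemma for operators commuting with an irreducible finite-dimensional
representation. -/
theorem exists_eq_smul_one_of_commute_of_irreducible {G H : Type*} [Group G]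
    [NormedAddCommGroup H] [NormedSpace ℂ H] [FiniteDimensional ℂ H] [Nontrivial H]
    (ρ : G →* (H →L[ℂ] H))
    (hirr : ∀ U : Submodule ℂ H, IsClosed (U : Set H) →
      (∀ g : G, ∀ v ∈ U, ρ g v ∈ U) → U = ⊥ ∨ U = ⊤)
    (Q : H →L[ℂ] H) (hQ : ∀ g, Commute (ρ g) Q) : ∃ c : ℂ, Q = c • 1 := by
  obtain ⟨c, hc⟩ := Module.End.exists_eigenvalue (Q : H →ₗ[ℂ] H)
  refine ⟨c, ?_⟩
  have hinv : ∀ g : G, ∀ v ∈ Module.End.eigenspace (Q : H →ₗ[ℂ] H) c,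
      ρ g v ∈ Module.End.eigenspace (Q : H →ₗ[ℂ] H) c := by
    intro g v hv
    rw [Module.End.mem_eigenspace_iff, ContinuousLinearMap.coe_coe] at hv ⊢
    have h : ρ g (Q v) = Q (ρ g v) := DFunLike.congr_fun (hQ g).eq v
    rw [← h, hv, map_smul]
  rcases hirr _ (Submodule.closed_of_finiteDimensional _) hinv with h | h
  · exact absurd h hc
  · ext v
    have hv : v ∈ Module.End.eigenspace (Q : H →ₗ[ℂ] H) c := h ▸ Submodule.mem_top
    exact Module.End.mem_eigenspace_iff.1 hv

/-- A commutative algebra of operators normalized by an irreducible finite-dimensional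
representation has no nonzero nilpotent elements. -/
theorem isReduced_of_normalized_of_irreducible {G H R : Type*} [Group G]
    [NormedAddCommGroup H] [NormedSpace ℂ H]
    [CommRing R] [IsNoetherianRing R] (φ : R →+* (H →L[ℂ] H)) (hφ : Function.Injective φ)
    (ρ : G →* (H →L[ℂ] H))
    (hirr : ∀ U : Submodule ℂ H, IsClosed (U : Set H) →
      (∀ g : G, ∀ v ∈ U, ρ g v ∈ U) → U = ⊥ ∨ U = ⊤)
    (hnorm : ∀ g, ∀ x : R, ∃ y : R, φ y = ρ g * φ x * ρ g⁻¹) :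
    IsReduced R := by
  classical
  have hρ : ∀ g, ρ g * ρ g⁻¹ = 1 := fun g => by rw [← map_mul, mul_inv_cancel, map_one]
  have hρ' : ∀ g, ρ g⁻¹ * ρ g = 1 := fun g => by rw [← map_mul, inv_mul_cancel, map_one]
  have hpow : ∀ g, ∀ T : H →L[ℂ] H, ∀ n : ℕ, (ρ g * T * ρ g⁻¹) ^ n = ρ g * T ^ n * ρ g⁻¹ := by
    intro g T n
    induction n with
    | zero => rw [pow_zero, pow_zero, mul_one, hρ]
    | succ n ih =>
      rw [pow_succ, ih, pow_succ]
      simp only [mul_assoc]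
      rw [← mul_assoc (ρ g⁻¹) (ρ g), hρ', one_mul]
  have hnil : ∀ g, ∀ x ∈ nilradical R, ∃ y ∈ nilradical R, φ y = ρ g * φ x * ρ g⁻¹ := by
    intro g x hx
    obtain ⟨y, hy⟩ := hnorm g x
    refine ⟨y, ?_, hy⟩
    obtain ⟨n, hn⟩ := mem_nilradical.1 hx
    refine mem_nilradical.2 ⟨n, hφ ?_⟩
    rw [map_pow, hy, hpow, ← map_pow, hn, map_zero, mul_zero, zero_mul]
  let U : Submodule ℂ H := ⨅ x : nilradical R, LinearMap.ker (φ x : H →ₗ[ℂ] H)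
  have hU : ∀ v, v ∈ U ↔ ∀ x ∈ nilradical R, φ x v = 0 := by
    intro v
    simp [U, Submodule.mem_iInf]
  have hclosed : IsClosed (U : Set H) := by
    rw [Submodule.coe_iInf]
    exact isClosed_iInter fun x => ContinuousLinearMap.isClosed_ker (φ x)
  have hinv : ∀ g : G, ∀ v ∈ U, ρ g v ∈ U := by
    intro g v hv
    rw [hU] at hv ⊢
    intro x hx
    obtain ⟨y, hyN, hy⟩ := hnil g⁻¹ x hx
    have h : φ x * ρ g = ρ g * φ y := by
      rw [hy, inv_inv, ← mul_assoc, ← mul_assoc, hρ, one_mul]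
    have h' : φ x (ρ g v) = ρ g (φ y v) := DFunLike.congr_fun h v
    rw [h', hv y hyN, map_zero]
  rw [← nilradical_eq_bot_iff]
  by_contra hne
  have hex : ∃ n, nilradical R ^ n = ⊥ := IsNoetherianRing.isNilpotent_nilradical R
  obtain ⟨n, hn⟩ : ∃ n, Nat.find hex = n + 1 := by
    refine Nat.exists_eq_succ_of_ne_zero fun h0 => hne ?_
    have h1 := Nat.find_spec hex
    rw [h0, pow_zero, Ideal.one_eq_top] at h1
    exact le_bot_iff.1 (h1 ▸ le_top)
  have hlast : nilradical R ^ (n + 1) = ⊥ := hn ▸ Nat.find_spec hex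
  have hprev : nilradical R ^ n ≠ ⊥ := Nat.find_min hex (hn ▸ Nat.lt_succ_self n)
  obtain ⟨x, hx, hx0⟩ := Submodule.exists_mem_ne_zero_of_ne_bot hprev
  have hmem : ∀ v, φ x v ∈ U := by
    intro v
    refine (hU _).2 fun y hy => ?_
    have h : y * x = 0 := by
      rw [← Ideal.mem_bot, ← hlast, pow_succ']
      exact Ideal.mul_mem_mul hy hx
    change (φ y * φ x) v = 0
    rw [← map_mul, h, map_zero]
    rfl
  rcases hirr U hclosed hinv with h | h
  · refine hx0 (hφ ?_)
    ext v
    rw [map_zero]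
    exact (Submodule.mem_bot ℂ).1 (h ▸ hmem v)
  · refine hne (le_bot_iff.1 fun y hy => Ideal.mem_bot.2 (hφ ?_))
    ext v
    rw [map_zero]
    exact (hU v).1 (h ▸ Submodule.mem_top) y hy

/-- A finite set of involutive operators that contains `1`, is closed under products and is
normalized by an irreducible finite-dimensional unitary representation consists of self-adjoint
operators. -/
theorem star_eq_self_of_involution_of_irreducible {G H : Type*} [Group G]
    [NormedAddCommGroup H] [InnerProductSpace ℂ H] [CompleteSpace H] [FiniteDimensional ℂ H]
    (ρ : G →* (H →L[ℂ] H)) (hstar : ∀ g, star (ρ g) = ρ g⁻¹)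
    (hirr : ∀ U : Submodule ℂ H, IsClosed (U : Set H) →
      (∀ g : G, ∀ v ∈ U, ρ g v ∈ U) → U = ⊥ ∨ U = ⊤)
    (F : Finset (H →L[ℂ] H)) (hone : 1 ∈ F) (hmul : ∀ s ∈ F, ∀ t ∈ F, s * t ∈ F)
    (hsq : ∀ s ∈ F, s * s = 1) (hconj : ∀ g, ∀ s ∈ F, ρ g * s * ρ g⁻¹ ∈ F)
    {s : H →L[ℂ] H} (hs : s ∈ F) : star s = s := by
  rcases subsingleton_or_nontrivial H with _ | _
  · exact Subsingleton.elim _ _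
  have hρ : ∀ g, ρ g * ρ g⁻¹ = 1 := fun g => by rw [← map_mul, mul_inv_cancel, map_one]
  have hρ' : ∀ g, ρ g⁻¹ * ρ g = 1 := fun g => by rw [← map_mul, inv_mul_cancel, map_one]
  let Q : H →L[ℂ] H := ∑ u ∈ F, star u * u
  have hQs : star s * Q * s = Q := by
    simp only [Q, Finset.mul_sum, Finset.sum_mul]
    refine Finset.sum_nbij' (· * s) (· * s) (fun u hu => hmul u hu s hs)
      (fun u hu => hmul u hu s hs) ?_ ?_ ?_
    · intro u _
      simp only [mul_assoc, hsq s hs, mul_one]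
    · intro u _
      simp only [mul_assoc, hsq s hs, mul_one]
    · intro u _
      simp only [star_mul, mul_assoc]
  have hQg : ∀ g, ρ g * Q * ρ g⁻¹ = Q := by
    intro g
    simp only [Q, Finset.mul_sum, Finset.sum_mul]
    refine Finset.sum_nbij' (fun u => ρ g * u * ρ g⁻¹) (fun u => ρ g⁻¹ * u * ρ g)
      (hconj g) (fun u hu => by simpa using hconj g⁻¹ u hu) ?_ ?_ ?_
    · intro u _
      simp only [mul_assoc, hρ', mul_one]
      rw [← mul_assoc, hρ', one_mul]
    · intro u _
      simp only [mul_assoc, hρ, mul_one]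
      rw [← mul_assoc, hρ, one_mul]
    · intro u _
      simp only [star_mul, hstar, inv_inv, mul_assoc]
      rw [← mul_assoc (ρ g⁻¹) (ρ g), hρ', one_mul]
  obtain ⟨c, hc⟩ := exists_eq_smul_one_of_commute_of_irreducible ρ hirr Q fun g => by
    change ρ g * Q = Q * ρ g
    conv_rhs => rw [← hQg g, mul_assoc, hρ', mul_one]
  have hc0 : c ≠ 0 := by
    rintro rfl
    obtain ⟨v, hv⟩ := exists_ne (0 : H)
    have hle : (1 : H →L[ℂ] H) ≤ Q := by
      have h := Finset.single_le_sum (f := fun u : H →L[ℂ] H => star u * u)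
        (fun u _ => star_mul_self_nonneg u) hone
      simpa using h
    rw [hc, zero_smul] at hle
    exact one_ne_zero (le_antisymm hle zero_le_one)
  have hss : star s * s = 1 := by
    rw [hc, mul_smul_comm, mul_one, smul_mul_assoc] at hQs
    exact smul_right_injective _ hc0 hQs
  calc star s = star s * (s * s) := by rw [hsq s hs, mul_one]
    _ = s := by rw [← mul_assoc, hss, one_mul]

/-- A commutative algebra of operators normalized by an irreducible finite-dimensional unitary
representation is closed under adjoints. -/
theorem exists_map_eq_star_of_normalized_of_irreducible {G H R : Type*} [Group G]
    [NormedAddCommGroup H] [InnerProductSpace ℂ H] [CompleteSpace H] [FiniteDimensional ℂ H]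
    [CommRing R] [Algebra ℂ R] (φ : R →ₐ[ℂ] (H →L[ℂ] H)) (hφ : Function.Injective φ)
    (ρ : G →* (H →L[ℂ] H)) (hstar : ∀ g, star (ρ g) = ρ g⁻¹)
    (hirr : ∀ U : Submodule ℂ H, IsClosed (U : Set H) →
      (∀ g : G, ∀ v ∈ U, ρ g v ∈ U) → U = ⊥ ∨ U = ⊤)
    (hnorm : ∀ g, ∀ x : R, ∃ y : R, φ y = ρ g * φ x * ρ g⁻¹) (x : R) :
    ∃ y : R, φ y = star (φ x) := by
  have : Module.Finite ℂ R := Module.Finite.of_injective φ.toLinearMap hφ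
  have : IsArtinianRing R := IsArtinianRing.of_finite ℂ R
  have : IsReduced R :=
    isReduced_of_normalized_of_irreducible (φ : R →+* (H →L[ℂ] H)) hφ ρ hirr hnorm
  have hF := (finite_setOf_mul_self_eq_one_of_isReduced R).image φ
  have hmem : ∀ s, s ∈ hF.toFinset ↔ ∃ u, u * u = 1 ∧ φ u = s := fun s =>
    hF.mem_toFinset
  have hsq : ∀ s ∈ hF.toFinset, s * s = 1 := by
    intro s hs
    obtain ⟨u, hu, rfl⟩ := (hmem s).1 hs
    rw [← map_mul, hu, map_one]
  have hmul : ∀ s ∈ hF.toFinset, ∀ t ∈ hF.toFinset, s * t ∈ hF.toFinset := by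
    intro s hs t ht
    obtain ⟨u, hu, rfl⟩ := (hmem s).1 hs
    obtain ⟨v, hv, rfl⟩ := (hmem t).1 ht
    exact (hmem _).2 ⟨u * v, by rw [mul_mul_mul_comm, hu, hv, mul_one], map_mul φ u v⟩
  have hconj : ∀ g, ∀ s ∈ hF.toFinset, ρ g * s * ρ g⁻¹ ∈ hF.toFinset := by
    intro g s hs
    obtain ⟨u, hu, rfl⟩ := (hmem s).1 hs
    obtain ⟨y, hy⟩ := hnorm g u
    refine (hmem _).2 ⟨y, hφ ?_, hy⟩
    have hρ : ρ g⁻¹ * ρ g = 1 := by rw [← map_mul, inv_mul_cancel, map_one]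
    calc φ (y * y) = ρ g * φ u * (ρ g⁻¹ * ρ g) * φ u * ρ g⁻¹ := by
          rw [map_mul, hy]
          simp only [mul_assoc]
      _ = φ 1 := by
          rw [hρ, mul_one, mul_assoc (ρ g), ← map_mul φ, hu, map_one, mul_one, ← map_mul,
            mul_inv_cancel, map_one]
  have hinvol : ∀ u : R, u * u = 1 → star (φ u) = φ u := fun u hu =>
    star_eq_self_of_involution_of_irreducible ρ hstar hirr hF.toFinset
      ((hmem 1).2 ⟨1, mul_one 1, map_one φ⟩) hmul hsq hconj ((hmem _).2 ⟨u, hu, rfl⟩)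
  have hidem : ∀ p : R, IsIdempotentElem p → star (φ p) = φ p := by
    intro p hp
    have h := hinvol ((2 : ℂ) • p - 1) (by
      simp only [two_smul, sub_mul, mul_sub, add_mul, mul_add, hp.eq, one_mul, mul_one]
      abel)
    rw [map_sub, map_one, map_smul, star_sub, star_one, star_smul, star_ofNat, sub_left_inj] at h
    exact smul_right_injective _ (two_ne_zero (α := ℂ)) h
  have hspan : x ∈ Submodule.span ℂ {p : R | IsIdempotentElem p} := by
    rw [span_setOf_isIdempotentElem_of_isReduced ℂ R]
    exact Submodule.mem_top
  induction hspan using Submodule.span_induction with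
  | mem p hp => exact ⟨p, (hidem p hp).symm⟩
  | zero => exact ⟨0, by simp⟩
  | add a b _ _ ha hb =>
    obtain ⟨a', ha⟩ := ha
    obtain ⟨b', hb⟩ := hb
    exact ⟨a' + b', by rw [map_add, map_add, star_add, ha, hb]⟩
  | smul c a _ ha =>
    obtain ⟨a', ha⟩ := ha
    exact ⟨star c • a', by rw [map_smul, map_smul, star_smul, ha]⟩

/-- Inductive algebras for a finite group are self-adjoint: if `π` is an
irreducible unitary representation of a finite group `G` on a complex Hilbert
space `H` and `A` is an abelian subalgebra of `B(H)` normalized by `π(G)`,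
then `A` is closed under adjoints. -/
theorem inductive_algebra_selfAdjoint_of_finite
    (G : Type*) [Group G] [Finite G]
    (H : Type*) [NormedAddCommGroup H] [InnerProductSpace ℂ H] [CompleteSpace H]
    (π : G →* unitary (H →L[ℂ] H))
    (hirr : ∀ U : Submodule ℂ H, IsClosed (U : Set H) →
      (∀ g : G, ∀ v ∈ U, (π g : H →L[ℂ] H) v ∈ U) → U = ⊥ ∨ U = ⊤)
    (A : Subalgebra ℂ (H →L[ℂ] H))
    (habelian : ∀ S ∈ A, ∀ T ∈ A, S * T = T * S)
    (hnorm : ∀ g : G,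
      (fun T : H →L[ℂ] H => (π g : H →L[ℂ] H) * T * ((π g)⁻¹ : unitary (H →L[ℂ] H))) '' A = A) :
    ∀ T ∈ A, star T ∈ A := by
  let ρ : G →* (H →L[ℂ] H) := (unitary (H →L[ℂ] H)).subtype.comp π
  have hstar : ∀ g, star (ρ g) = ρ g⁻¹ := by
    intro g
    simp only [ρ, MonoidHom.comp_apply, map_inv]
    rfl
  have hconj : ∀ g, ∀ T ∈ A, ρ g * T * ρ g⁻¹ ∈ A := by
    intro g T hT
    have h := (hnorm g).subset ⟨T, hT, rfl⟩
    rw [← map_inv] at h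
    exact h
  have hfin : FiniteDimensional ℂ H := finiteDimensional_of_finite_of_irreducible ρ hirr
  let _ : CommRing A :=
    { (inferInstance : Ring A) with
      mul_comm := fun S T => Subtype.ext (habelian S S.2 T T.2) }
  intro T hT
  obtain ⟨S, hS⟩ := exists_map_eq_star_of_normalized_of_irreducible A.val
    Subtype.val_injective ρ hstar hirr (fun g x => ⟨⟨_, hconj g x x.2⟩, rfl⟩) ⟨T, hT⟩
  exact hS ▸ S.2
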